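/- Let B1 and B2 be independent random variables taking values in [0,1/2]. Then Cov(ℋ(B1∗B2), ℋ(B1) + ℋ(B2) − ℋ(B1∗B2)) ≥ 0. -/

import Mathlib

open MeasureTheory ProbabilityTheory

/-- The binary entropy function `ℋ(p) = -p log₂ p - (1-p) log₂ (1-p)`. -/
noncomputable def binH (p : ℝ) : ℝ := -(p * Real.logb 2 p) - (1 - p) * Real.logb 2 (1 - p)

/-- The convolution `p ∗ q = pq + (1-p)(1-q)`. -/
noncomputable def pstar (p q : ℝ) : ℝ := p * q + (1 - p) * (1 - q)

/-- Covariance of two real random variables: `Cov(F,G) = E[FG] - E[F]E[G]`. -/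
noncomputable def cov {Ω : Type*} [MeasurableSpace Ω] (μ : Measure Ω) (F G : Ω → ℝ) : ℝ :=
  (∫ ω, F ω * G ω ∂μ) - (∫ ω, F ω ∂μ) * (∫ ω, G ω ∂μ)


theorem aux_integrable {α : Type*} [MeasurableSpace α] (ν : Measure α) [IsProbabilityMeasure ν]
    (f : α → ℝ) (hf : StronglyMeasurable f) (C : ℝ) (hC : ∀ x, |f x| ≤ C) : Integrable f ν :=
  Integrable.of_bound hf.aestronglyMeasurable C (Filter.Eventually.of_forall hC)

/-- Chebyshev's association inequality in one variable. -/
theorem aux_cheb (ν : Measure ℝ) [IsProbabilityMeasure ν] (f g : ℝ → ℝ)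
    (hf : StronglyMeasurable f) (hg : StronglyMeasurable g) (C : ℝ)
    (hfC : ∀ x, |f x| ≤ C) (hgC : ∀ x, |g x| ≤ C) (hfm : Monotone f) (hgm : Monotone g) :
    (∫ x, f x ∂ν) * (∫ x, g x ∂ν) ≤ ∫ x, f x * g x ∂ν := by
  have If := aux_integrable ν f hf C hfC
  have Ig := aux_integrable ν g hg C hgC
  have Ifg : Integrable (fun x => f x * g x) ν := by
    refine aux_integrable ν _ (hf.mul hg) (C * C) fun x => ?_
    rw [abs_mul]
    exact mul_le_mul (hfC x) (hgC x) (abs_nonneg _) ((abs_nonneg _).trans (hfC x))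
  have h1 : ∀ x, 0 ≤ f x * g x - f x * (∫ y, g y ∂ν) - (∫ y, f y ∂ν) * g x
      + ∫ y, f y * g y ∂ν := by
    intro x
    have h : 0 ≤ ∫ y, (f x * g x - f x * g y - f y * g x + f y * g y) ∂ν := by
      refine integral_nonneg fun y => ?_
      have : 0 ≤ (f x - f y) * (g x - g y) := by
        rcases le_total x y with h | h
        · exact mul_nonneg_of_nonpos_of_nonpos (sub_nonpos.2 (hfm h)) (sub_nonpos.2 (hgm h))
        · exact mul_nonneg (sub_nonneg.2 (hfm h)) (sub_nonneg.2 (hgm h))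
      simp only [Pi.zero_apply]
      linarith
    have i1 : Integrable (fun y => f x * g x - f x * g y) ν :=
      (integrable_const _).sub (Ig.const_mul _)
    have i2 : Integrable (fun y => f x * g x - f x * g y - f y * g x) ν :=
      i1.sub (If.mul_const _)
    rw [integral_add i2 Ifg, integral_sub i1 (If.mul_const _),
      integral_sub (integrable_const _) (Ig.const_mul _), integral_const_mul,
      integral_mul_const] at h
    simpa [integral_const_mul] using h
  have h2 : 0 ≤ ∫ x, (f x * g x - f x * (∫ y, g y ∂ν) - (∫ y, f y ∂ν) * g x
      + ∫ y, f y * g y ∂ν) ∂ν := integral_nonneg h1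
  have i1 : Integrable (fun x => f x * g x - f x * (∫ y, g y ∂ν)) ν := Ifg.sub (If.mul_const _)
  have i2 : Integrable (fun x => f x * g x - f x * (∫ y, g y ∂ν) - (∫ y, f y ∂ν) * g x) ν :=
    i1.sub (Ig.const_mul _)
  rw [integral_add i2 (integrable_const _), integral_sub i1 (Ig.const_mul _),
    integral_sub Ifg (If.mul_const _), integral_const_mul, integral_mul_const] at h2
  simp at h2
  linarith

/-- Harris' inequality in two variables. -/
theorem aux_harris (ν₁ ν₂ : Measure ℝ) [IsProbabilityMeasure ν₁] [IsProbabilityMeasure ν₂]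
    (f g : ℝ × ℝ → ℝ) (hf : Continuous f) (hg : Continuous g) (C : ℝ)
    (hfC : ∀ x, |f x| ≤ C) (hgC : ∀ x, |g x| ≤ C) (hfm : Monotone f) (hgm : Monotone g) :
    (∫ z, f z ∂(ν₁.prod ν₂)) * (∫ z, g z ∂(ν₁.prod ν₂)) ≤ ∫ z, f z * g z ∂(ν₁.prod ν₂) := by
  have sf := hf.stronglyMeasurable
  have sg := hg.stronglyMeasurable
  have If := aux_integrable (ν₁.prod ν₂) f sf C hfC
  have Ig := aux_integrable (ν₁.prod ν₂) g sg C hgC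
  have Ifg : Integrable (fun x => f x * g x) (ν₁.prod ν₂) := by
    refine aux_integrable _ _ (sf.mul sg) (C * C) fun x => ?_
    rw [abs_mul]
    exact mul_le_mul (hfC x) (hgC x) (abs_nonneg _) ((abs_nonneg _).trans (hfC x))
  rw [integral_prod _ If, integral_prod _ Ig, integral_prod _ Ifg]
  have key : ∀ u : ℝ × ℝ → ℝ, StronglyMeasurable u → (∀ x, |u x| ≤ C) → Monotone u →
      StronglyMeasurable (fun x => ∫ y, u (x, y) ∂ν₂) ∧ (∀ x, |∫ y, u (x, y) ∂ν₂| ≤ C) ∧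
      Monotone (fun x => ∫ y, u (x, y) ∂ν₂) := by
    intro u hu huC hum
    have hI : ∀ x, Integrable (fun y => u (x, y)) ν₂ := fun x =>
      aux_integrable ν₂ _ (hu.comp_measurable measurable_prodMk_left) C fun y => huC _
    refine ⟨hu.integral_prod_right', fun x => ?_, fun a b hab => ?_⟩
    · have := norm_integral_le_of_norm_le_const (μ := ν₂) (f := fun y => u (x, y)) (C := C)
        (Filter.Eventually.of_forall fun y => huC _)
      simpa using this
    · exact integral_mono (hI a) (hI b) fun y => hum (Prod.mk_le_mk.2 ⟨hab, le_rfl⟩)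
  obtain ⟨f1, f2, f3⟩ := key f sf hfC hfm
  obtain ⟨g1, g2, g3⟩ := key g sg hgC hgm
  refine (aux_cheb ν₁ _ _ f1 g1 C f2 g2 f3 g3).trans ?_
  refine integral_mono ?_ Ifg.integral_prod_left fun x => ?_
  · refine aux_integrable ν₁ _ (f1.mul g1) (C * C) fun x => ?_
    rw [abs_mul]
    exact mul_le_mul (f2 x) (g2 x) (abs_nonneg _) ((abs_nonneg _).trans (f2 x))
  · exact aux_cheb ν₂ (fun y => f (x, y)) (fun y => g (x, y))
      (sf.comp_measurable measurable_prodMk_left) (sg.comp_measurable measurable_prodMk_left) C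
      (fun y => hfC _) (fun y => hgC _) (fun a b hab => hfm (Prod.mk_le_mk.2 ⟨le_rfl, hab⟩))
      (fun a b hab => hgm (Prod.mk_le_mk.2 ⟨le_rfl, hab⟩))

theorem binH_eq (p : ℝ) : binH p = Real.binEntropy p / Real.log 2 := by
  unfold binH Real.logb
  rw [Real.binEntropy_eq_negMulLog_add_negMulLog_one_sub]
  simp only [Real.negMulLog]
  ring

/-- `1 - p ∗ q`. -/
noncomputable def cst (p q : ℝ) : ℝ := p * (1 - 2 * q) + q

theorem binH_pstar (p q : ℝ) : binH (pstar p q) = Real.binEntropy (cst p q) / Real.log 2 := by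
  rw [binH_eq, ← Real.binEntropy_one_sub]
  congr 2
  unfold pstar cst
  ring

theorem cst_comm (p q : ℝ) : cst p q = cst q p := by unfold cst; ring

theorem cst_mem {p q : ℝ} (hp : p ∈ Set.Icc (0:ℝ) (1/2)) (hq : q ∈ Set.Icc (0:ℝ) (1/2)) :
    cst p q ∈ Set.Icc (0:ℝ) (1/2) := by
  obtain ⟨a, b⟩ := hp
  obtain ⟨c, d⟩ := hq
  unfold cst
  constructor <;> nlinarith

theorem F_mono {p p' q : ℝ} (hp : p ∈ Set.Icc (0:ℝ) (1/2)) (hp' : p' ∈ Set.Icc (0:ℝ) (1/2))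
    (hq : q ∈ Set.Icc (0:ℝ) (1/2)) (h : p ≤ p') :
    Real.binEntropy (cst p q) ≤ Real.binEntropy (cst p' q) := by
  have m := Real.binEntropy_strictMonoOn.monotoneOn
  have e : (2⁻¹ : ℝ) = 1/2 := by norm_num
  rw [e] at m
  refine m (cst_mem hp hq) (cst_mem hp' hq) ?_
  unfold cst
  obtain ⟨c, d⟩ := hq
  nlinarith

theorem G_mono {p p' q : ℝ} (hp : p ∈ Set.Icc (0:ℝ) (1/2)) (hp' : p' ∈ Set.Icc (0:ℝ) (1/2))
    (hq : q ∈ Set.Icc (0:ℝ) (1/2)) (h : p ≤ p') :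
    Real.binEntropy p - Real.binEntropy (cst p q) ≤
      Real.binEntropy p' - Real.binEntropy (cst p' q) := by
  have hd : ∀ x ∈ Set.Ioo (0:ℝ) (1/2), HasDerivAt
      (fun p => Real.binEntropy p - Real.binEntropy (cst p q))
      ((Real.log (1 - x) - Real.log x) -
        (Real.log (1 - cst x q) - Real.log (cst x q)) * (1 - 2 * q)) x := by
    intro x hx
    have hc : 0 < cst x q := by
      unfold cst; obtain ⟨c, d⟩ := hq; obtain ⟨a, b⟩ := hx; nlinarith
    have hc' := (cst_mem ⟨hx.1.le, hx.2.le⟩ hq).2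
    have h1 := Real.hasDerivAt_binEntropy (p := x) (by linarith [hx.1]) (by linarith [hx.2])
    have h2 := Real.hasDerivAt_binEntropy (p := cst x q) (by linarith) (by linarith)
    have h3 : HasDerivAt (fun p => cst p q) (1 - 2 * q) x := by
      unfold cst
      simpa using ((hasDerivAt_id x).mul_const (1 - 2 * q)).add_const q
    exact h1.sub (HasDerivAt.comp (h₂ := Real.binEntropy) x h2 h3)
  have m : MonotoneOn (fun p => Real.binEntropy p - Real.binEntropy (cst p q))
      (Set.Icc (0:ℝ) (1/2)) := by
    refine monotoneOn_of_deriv_nonneg (convex_Icc _ _) ?_ ?_ ?_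
    · refine Continuous.continuousOn ?_
      refine Real.binEntropy_continuous.sub (Real.binEntropy_continuous.comp ?_)
      unfold cst
      fun_prop
    · rw [interior_Icc]
      exact fun x hx => (hd x hx).differentiableAt.differentiableWithinAt
    · rw [interior_Icc]
      intro x hx
      rw [(hd x hx).deriv]
      have hc := cst_mem ⟨hx.1.le, hx.2.le⟩ hq
      have hxc : x ≤ cst x q := by
        unfold cst; obtain ⟨c, d⟩ := hq; obtain ⟨a, b⟩ := hx; nlinarith
      have l1 : Real.log x ≤ Real.log (cst x q) := Real.log_le_log hx.1 hxc
      have l2 : Real.log (1 - cst x q) ≤ Real.log (1 - x) :=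
        Real.log_le_log (by linarith [hc.2]) (by linarith)
      have l3 : Real.log (cst x q) ≤ Real.log (1 - cst x q) :=
        Real.log_le_log (by linarith [hx.1]) (by linarith [hc.2])
      have := mul_nonneg (sub_nonneg.2 l3) hq.1
      nlinarith
  exact m hp hp' h

/-- Clipping to `[0,1/2]`. -/
noncomputable def clip (t : ℝ) : ℝ := max 0 (min t (1/2))

theorem clip_mem (t : ℝ) : clip t ∈ Set.Icc (0:ℝ) (1/2) := by
  unfold clip
  exact ⟨le_max_left _ _, max_le (by norm_num) (min_le_right _ _)⟩

theorem clip_mono : Monotone clip := fun a b h => by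
  unfold clip
  exact max_le_max le_rfl (min_le_min h le_rfl)

theorem clip_cont : Continuous clip := by unfold clip; fun_prop

theorem clip_eq {t : ℝ} (h : t ∈ Set.Icc (0:ℝ) (1/2)) : clip t = t := by
  unfold clip
  rw [min_eq_left h.2, max_eq_right h.1]

noncomputable def FF (z : ℝ × ℝ) : ℝ := Real.binEntropy (cst (clip z.1) (clip z.2)) / Real.log 2

noncomputable def GG (z : ℝ × ℝ) : ℝ :=
  (Real.binEntropy (clip z.1) + Real.binEntropy (clip z.2)
    - Real.binEntropy (cst (clip z.1) (clip z.2))) / Real.log 2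

theorem FF_cont : Continuous FF := by
  unfold FF cst
  have := clip_cont
  have := Real.binEntropy_continuous
  fun_prop

theorem GG_cont : Continuous GG := by
  unfold GG cst
  have := clip_cont
  have := Real.binEntropy_continuous
  fun_prop

theorem FF_mono : Monotone FF := by
  rintro ⟨a, b⟩ ⟨c, d⟩ h
  obtain ⟨h1, h2⟩ := Prod.mk_le_mk.1 h
  unfold FF
  refine div_le_div_of_nonneg_right ?_ (Real.log_nonneg (by norm_num))
  refine (F_mono (clip_mem a) (clip_mem c) (clip_mem b) (clip_mono h1)).trans ?_
  rw [cst_comm _ (clip b), cst_comm _ (clip d)]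
  exact F_mono (clip_mem b) (clip_mem d) (clip_mem c) (clip_mono h2)

theorem GG_mono : Monotone GG := by
  rintro ⟨a, b⟩ ⟨c, d⟩ h
  obtain ⟨h1, h2⟩ := Prod.mk_le_mk.1 h
  unfold GG
  refine div_le_div_of_nonneg_right ?_ (Real.log_nonneg (by norm_num))
  have e1 := G_mono (clip_mem a) (clip_mem c) (clip_mem b) (clip_mono h1)
  have e2 := G_mono (clip_mem b) (clip_mem d) (clip_mem c) (clip_mono h2)
  rw [cst_comm (clip b), cst_comm (clip d)] at e2
  dsimp only
  linarith

theorem ent_bd {p : ℝ} (h : p ∈ Set.Icc (0:ℝ) (1/2)) :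
    0 ≤ Real.binEntropy p ∧ Real.binEntropy p ≤ Real.log 2 :=
  ⟨Real.binEntropy_nonneg h.1 (by linarith [h.2]), Real.binEntropy_le_log_two⟩

theorem FF_bd (z : ℝ × ℝ) : |FF z| ≤ 2 := by
  have hl : 0 < Real.log 2 := Real.log_pos (by norm_num)
  obtain ⟨a, b⟩ := ent_bd (cst_mem (clip_mem z.1) (clip_mem z.2))
  unfold FF
  rw [abs_div, abs_of_pos hl, div_le_iff₀ hl, abs_le]
  constructor <;> linarith

theorem GG_bd (z : ℝ × ℝ) : |GG z| ≤ 2 := by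
  have hl : 0 < Real.log 2 := Real.log_pos (by norm_num)
  obtain ⟨a, b⟩ := ent_bd (cst_mem (clip_mem z.1) (clip_mem z.2))
  obtain ⟨a1, b1⟩ := ent_bd (clip_mem z.1)
  obtain ⟨a2, b2⟩ := ent_bd (clip_mem z.2)
  unfold GG
  rw [abs_div, abs_of_pos hl, div_le_iff₀ hl, abs_le]
  constructor <;> linarith

/-- For independent `[0,1/2]`-valued random variables `B₁, B₂`,
`Cov(ℋ(B₁∗B₂), ℋ(B₁) + ℋ(B₂) - ℋ(B₁∗B₂)) ≥ 0`. -/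
theorem cov2_nonneg
    {Ω : Type*} [MeasurableSpace Ω] (μ : Measure Ω) [IsProbabilityMeasure μ]
    (B₁ B₂ : Ω → ℝ) (hB₁ : Measurable B₁) (hB₂ : Measurable B₂)
    (hB₁r : ∀ ω, B₁ ω ∈ Set.Icc (0:ℝ) (1/2)) (hB₂r : ∀ ω, B₂ ω ∈ Set.Icc (0:ℝ) (1/2))
    (hindep : IndepFun B₁ B₂ μ) :
    0 ≤ cov μ (fun ω => binH (pstar (B₁ ω) (B₂ ω)))
              (fun ω => binH (B₁ ω) + binH (B₂ ω) - binH (pstar (B₁ ω) (B₂ ω))) := by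
  have hF : ∀ ω, binH (pstar (B₁ ω) (B₂ ω)) = FF (B₁ ω, B₂ ω) := fun ω => by
    simp only [FF, binH_pstar, clip_eq (hB₁r ω), clip_eq (hB₂r ω)]
  have hG : ∀ ω, binH (B₁ ω) + binH (B₂ ω) - binH (pstar (B₁ ω) (B₂ ω)) = GG (B₁ ω, B₂ ω) :=
    fun ω => by
      rw [binH_pstar, binH_eq, binH_eq]
      simp only [GG, clip_eq (hB₁r ω), clip_eq (hB₂r ω)]
      ring
  have hm : Measurable (fun ω => (B₁ ω, B₂ ω)) := hB₁.prodMk hB₂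
  have hprod := (indepFun_iff_map_prod_eq_prod_map_map hB₁.aemeasurable hB₂.aemeasurable).1 hindep
  have := Measure.isProbabilityMeasure_map (μ := μ) hB₁.aemeasurable
  have := Measure.isProbabilityMeasure_map (μ := μ) hB₂.aemeasurable
  have H := aux_harris (μ.map B₁) (μ.map B₂) FF GG FF_cont GG_cont 2 FF_bd GG_bd FF_mono GG_mono
  have c3 : Continuous (fun z => FF z * GG z) := FF_cont.mul GG_cont
  rw [← hprod, integral_map hm.aemeasurable FF_cont.aestronglyMeasurable,
    integral_map hm.aemeasurable GG_cont.aestronglyMeasurable,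
    integral_map hm.aemeasurable c3.aestronglyMeasurable] at H
  unfold cov
  simp only [hG]
  simp only [hF]
  linarith
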